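/- arXiv:1706.09164 — 9 statements merged into one kernel-verified Lean document; each statement's English description precedes it below -/
import Mathlib

section
/- Let X be a topological space and A, B disjoint subsets of X. Let I₃ be the three-point indiscrete space on points {A, x, B}, and let i : X → I₃ send points of A to A, points of B to B, and all other points to x. Let W_A be the four-point space on {A, U_A, x, B} whose open sets are the up-sets of the preorder generated by A ≤ U_A, U_A ≤ A, x ≤ U_A, x ≤ B, B ≤ x (p ≤ q meaning p ∈ cl{q}), with quotient map q_A : W_A → I₃ gluing U_A to x; and let W_B be the analogous space on {A, x, U_B, B} with A ↔ x and x ≤ U_B ↔ B, with quotient map q_B : W_B → I₃ gluing U_B to x. Then A and B are separated (A ∩ cl B = ∅ and B ∩ cl A = ∅) if and only if i factors continuously through q_A (i.e. i = q_A ∘ h for some continuous h : X → W_A) and i factors continuously through q_B. -/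
/-- The Alexandrov topology on a preordered set: open sets are exactly the
upward-closed sets (here `p ≤ q` means `p ∈ closure {q}`). -/
def upTop (α : Type*) [Preorder α] : TopologicalSpace α where
  IsOpen s := ∀ ⦃a b : α⦄, a ∈ s → a ≤ b → b ∈ s
  isOpen_univ := fun _ _ _ _ => trivial
  isOpen_inter := fun s t hs ht a b hab hle => ⟨hs hab.1 hle, ht hab.2 hle⟩
  isOpen_sUnion := fun S hS a b ha hle => by
    obtain ⟨s, hsS, has⟩ := ha
    exact ⟨s, hsS, hS s hsS has hle⟩

/-- The preorder generated by a relation `r`: its `≤` is the reflexive-transitive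
closure of `r`. -/
def genPreorder {α : Type*} (r : α → α → Prop) : Preorder α where
  le := Relation.ReflTransGen r
  le_refl _ := Relation.ReflTransGen.refl
  le_trans _ _ _ h h' := Relation.ReflTransGen.trans h h'

/-- The three-point space on points `{A, x, B}`. -/
inductive I3 | A | x | B

/-- The indiscrete topology on `I3`: only `∅` and the whole space are open. -/
instance : TopologicalSpace I3 := ⊤

open Classical in
/-- The map `i : X → I₃` sending points of `A` to `A`, points of `B` to `B`,
and all other points to `x`. -/
noncomputable def iAB {X : Type*} (A B : Set X) : X → I3 := fun p =>
  if p ∈ A then I3.A else if p ∈ B then I3.B else I3.x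

/-- The four-point space on `{A, U_A, x, B}`. -/
inductive WA | A | UA | x | B

/-- Generating relation for the preorder on `WA`:
`A ≤ U_A`, `U_A ≤ A`, `x ≤ U_A`, `x ≤ B`, `B ≤ x`. -/
def rWA : WA → WA → Prop := fun p q =>
  (p = WA.A ∧ q = WA.UA) ∨ (p = WA.UA ∧ q = WA.A) ∨ (p = WA.x ∧ q = WA.UA) ∨
  (p = WA.x ∧ q = WA.B) ∨ (p = WA.B ∧ q = WA.x)

instance : Preorder WA := genPreorder rWA
instance : TopologicalSpace WA := upTop WA

/-- The quotient map `q_A : W_A → I₃` gluing `U_A` to `x`. -/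
def qA : WA → I3
  | WA.A => I3.A
  | WA.UA => I3.x
  | WA.x => I3.x
  | WA.B => I3.B

/-- The four-point space on `{A, x, U_B, B}`. -/
inductive WB | A | x | UB | B

/-- Generating relation for the preorder on `WB`:
`A ↔ x` and `x ≤ U_B ↔ B`. -/
def rWB : WB → WB → Prop := fun p q =>
  (p = WB.A ∧ q = WB.x) ∨ (p = WB.x ∧ q = WB.A) ∨ (p = WB.x ∧ q = WB.UB) ∨
  (p = WB.UB ∧ q = WB.B) ∨ (p = WB.B ∧ q = WB.UB)

instance : Preorder WB := genPreorder rWB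
instance : TopologicalSpace WB := upTop WB

/-- The quotient map `q_B : W_B → I₃` gluing `U_B` to `x`. -/
def qB : WB → I3
  | WB.A => I3.A
  | WB.x => I3.x
  | WB.UB => I3.x
  | WB.B => I3.B

theorem isOpen_upTop_genPreorder_iff {α : Type*} (r : α → α → Prop) (s : Set α) :
    (@upTop α (genPreorder r)).IsOpen s ↔ ∀ ⦃a b : α⦄, r a b → a ∈ s → b ∈ s := by
  refine ⟨fun h a b hab ha => h ha (.single hab), fun h a b ha hab => ?_⟩
  change Relation.ReflTransGen r a b at hab
  induction hab with
  | refl => exact ha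
  | tail _ hr ih => exact h hr ih

theorem WA.isOpen_iff (s : Set WA) :
    IsOpen s ↔ s = ∅ ∨ s = {WA.A, WA.UA} ∨ s = Set.univ := by
  refine (isOpen_upTop_genPreorder_iff rWA s).trans ⟨fun h => ?_, ?_⟩
  · have hAU : WA.A ∈ s → WA.UA ∈ s := h (by simp [rWA])
    have hUA : WA.UA ∈ s → WA.A ∈ s := h (by simp [rWA])
    have hxU : WA.x ∈ s → WA.UA ∈ s := h (by simp [rWA])
    have hxB : WA.x ∈ s → WA.B ∈ s := h (by simp [rWA])
    have hBx : WA.B ∈ s → WA.x ∈ s := h (by simp [rWA])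
    by_cases hx : WA.x ∈ s
    · right; right; ext p; cases p <;> simp_all
    · by_cases hA : WA.A ∈ s
      · right; left; ext p; cases p <;> simp_all
      · left; ext p; cases p <;> simp_all
  · rintro (rfl | rfl | rfl) p q <;> cases p <;> cases q <;> simp [rWA]

theorem WB.isOpen_iff (s : Set WB) :
    IsOpen s ↔ s = ∅ ∨ s = {WB.UB, WB.B} ∨ s = Set.univ := by
  refine (isOpen_upTop_genPreorder_iff rWB s).trans ⟨fun h => ?_, ?_⟩
  · have hAx : WB.A ∈ s → WB.x ∈ s := h (by simp [rWB])
    have hxA : WB.x ∈ s → WB.A ∈ s := h (by simp [rWB])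
    have hxU : WB.x ∈ s → WB.UB ∈ s := h (by simp [rWB])
    have hUB : WB.UB ∈ s → WB.B ∈ s := h (by simp [rWB])
    have hBU : WB.B ∈ s → WB.UB ∈ s := h (by simp [rWB])
    by_cases hx : WB.x ∈ s
    · right; right; ext p; cases p <;> simp_all
    · by_cases hB : WB.B ∈ s
      · right; left; ext p; cases p <;> simp_all
      · left; ext p; cases p <;> simp_all
  · rintro (rfl | rfl | rfl) p q <;> cases p <;> cases q <;> simp [rWB]

theorem WA.continuous_iff {X : Type*} [TopologicalSpace X] (h : X → WA) :
    Continuous h ↔ IsOpen (h ⁻¹' {WA.A, WA.UA}) := by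
  refine ⟨fun hc => ((WA.isOpen_iff _).2 (.inr (.inl rfl))).preimage hc,
    fun ho => continuous_def.2 fun s hs => ?_⟩
  rcases (WA.isOpen_iff s).1 hs with rfl | rfl | rfl
  exacts [isOpen_empty, ho, isOpen_univ]

theorem WB.continuous_iff {X : Type*} [TopologicalSpace X] (h : X → WB) :
    Continuous h ↔ IsOpen (h ⁻¹' {WB.UB, WB.B}) := by
  refine ⟨fun hc => ((WB.isOpen_iff _).2 (.inr (.inl rfl))).preimage hc,
    fun ho => continuous_def.2 fun s hs => ?_⟩
  rcases (WB.isOpen_iff s).1 hs with rfl | rfl | rfl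
  exacts [isOpen_empty, ho, isOpen_univ]

theorem inter_closure_eq_empty_iff {X : Type*} [TopologicalSpace X] (A B : Set X) :
    A ∩ closure B = ∅ ↔ ∃ V, IsOpen V ∧ A ⊆ V ∧ Disjoint V B := by
  rw [← Set.disjoint_iff_inter_eq_empty]
  constructor
  · exact fun h => ⟨(closure B)ᶜ, isClosed_closure.isOpen_compl, h.subset_compl_right,
      (Set.disjoint_compl_left_iff_subset).2 subset_closure⟩
  · rintro ⟨V, hV, hAV, hVB⟩
    exact (hVB.closure_right hV).mono_left hAV

theorem exists_continuous_lift_qA_iff {X : Type*} [TopologicalSpace X] {A B : Set X}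
    (hAB : Disjoint A B) :
    (∃ h : X → WA, Continuous h ∧ iAB A B = qA ∘ h) ↔ A ∩ closure B = ∅ := by
  classical
  rw [inter_closure_eq_empty_iff]
  constructor
  · rintro ⟨h, hc, hi⟩
    refine ⟨_, (WA.continuous_iff h).1 hc, fun p hp => ?_, Set.disjoint_left.2 fun p hp hB => ?_⟩
    · have := congrFun hi p
      cases hq : h p <;> simp_all [iAB, qA]
    · have := congrFun hi p
      have hA : p ∉ A := hAB.notMem_of_mem_right hB
      cases hq : h p <;> simp_all [iAB, qA]
  · rintro ⟨V, hV, hAV, hVB⟩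
    let h : X → WA := fun p =>
      if p ∈ A then WA.A else if p ∈ V then WA.UA else if p ∈ B then WA.B else WA.x
    have hpre : h ⁻¹' {WA.A, WA.UA} = V := by
      ext p
      have := @hAV p
      simp only [h, Set.mem_preimage]
      split_ifs <;> simp_all
    refine ⟨h, (WA.continuous_iff h).2 (hpre ▸ hV), funext fun p => ?_⟩
    have : p ∈ V → p ∉ B := fun hp => Set.disjoint_left.1 hVB hp
    simp only [h, iAB, Function.comp_apply]
    split_ifs <;> simp_all [qA]

theorem exists_continuous_lift_qB_iff {X : Type*} [TopologicalSpace X] {A B : Set X}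
    (hAB : Disjoint A B) :
    (∃ h : X → WB, Continuous h ∧ iAB A B = qB ∘ h) ↔ B ∩ closure A = ∅ := by
  classical
  rw [inter_closure_eq_empty_iff]
  constructor
  · rintro ⟨h, hc, hi⟩
    refine ⟨_, (WB.continuous_iff h).1 hc, fun p hp => ?_, Set.disjoint_left.2 fun p hp hA => ?_⟩
    · have := congrFun hi p
      have hA : p ∉ A := hAB.notMem_of_mem_right hp
      cases hq : h p <;> simp_all [iAB, qB]
    · have := congrFun hi p
      cases hq : h p <;> simp_all [iAB, qB]
  · rintro ⟨V, hV, hBV, hVA⟩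
    let h : X → WB := fun p =>
      if p ∈ B then WB.B else if p ∈ V then WB.UB else if p ∈ A then WB.A else WB.x
    have hpre : h ⁻¹' {WB.UB, WB.B} = V := by
      ext p
      have := @hBV p
      simp only [h, Set.mem_preimage]
      split_ifs <;> simp_all
    refine ⟨h, (WB.continuous_iff h).2 (hpre ▸ hV), funext fun p => ?_⟩
    have : p ∈ V → p ∉ A := fun hp => Set.disjoint_left.1 hVA hp
    have := @hBV p
    simp only [h, iAB, Function.comp_apply]
    split_ifs <;> simp_all [qB]

/-- Disjoint subsets `A` and `B` of a topological space `X` are separated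
(`A ∩ closure B = ∅` and `B ∩ closure A = ∅`) iff the map `i : X → I₃` factors
continuously both through `q_A : W_A → I₃` and through `q_B : W_B → I₃`. -/
theorem statement2 {X : Type*} [TopologicalSpace X] (A B : Set X)
    (hAB : Disjoint A B) :
    (A ∩ closure B = ∅ ∧ B ∩ closure A = ∅) ↔
      ((∃ h : X → WA, Continuous h ∧ iAB A B = qA ∘ h) ∧
       (∃ h : X → WB, Continuous h ∧ iAB A B = qB ∘ h)) := by
  rw [exists_continuous_lift_qA_iff hAB, exists_continuous_lift_qB_iff hAB]
end

section
/- Let X be a topological space and A, B disjoint subsets of X. Let I₃ be the three-point indiscrete space on points {A, x, B}, and let i : X → I₃ send points of A to A, points of B to B, and all other points to x. Let W be the five-point space on {A, U_A, x, U_B, B} whose open sets are the up-sets of the preorder generated by A ↔ U_A, x ≤ U_A, x ≤ U_B, B ↔ U_B, and let q : W → I₃ be the map gluing U_A, x, U_B to the single point x. Then A and B are separated by neighbourhoods (A and B have disjoint open neighbourhoods in X) if and only if i factors continuously through q, i.e. i = q ∘ h for some continuous h : X → W. -/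
/-- The five-point space on `{A, U_A, x, U_B, B}`. -/
inductive W5 | A | UA | x | UB | B

/-- Generating relation for the preorder on `W5`:
`A ↔ U_A`, `x ≤ U_A`, `x ≤ U_B`, `U_B ↔ B`. -/
def rW5 : W5 → W5 → Prop := fun p q =>
  (p = W5.A ∧ q = W5.UA) ∨ (p = W5.UA ∧ q = W5.A) ∨ (p = W5.x ∧ q = W5.UA) ∨
  (p = W5.x ∧ q = W5.UB) ∨ (p = W5.UB ∧ q = W5.B) ∨ (p = W5.B ∧ q = W5.UB)

instance : Preorder W5 := genPreorder rW5
instance : TopologicalSpace W5 := upTop W5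

/-- The quotient map `q : W → I₃` gluing `U_A`, `x`, `U_B` to the single point `x`. -/
def q5 : W5 → I3
  | W5.A => I3.A
  | W5.UA => I3.x
  | W5.x => I3.x
  | W5.UB => I3.x
  | W5.B => I3.B

theorem W5.isOpen_iff {s : Set W5} :
    IsOpen s ↔ (W5.A ∈ s ↔ W5.UA ∈ s) ∧ (W5.B ∈ s ↔ W5.UB ∈ s) ∧
      (W5.x ∈ s → W5.UA ∈ s ∧ W5.UB ∈ s) := by
  constructor
  · intro hs
    have step : ∀ {a b : W5}, rW5 a b → a ∈ s → b ∈ s := fun hr ha =>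
      hs ha (Relation.ReflTransGen.single hr)
    refine ⟨⟨step ?_, step ?_⟩, ⟨step ?_, step ?_⟩, fun h => ⟨step ?_ h, step ?_ h⟩⟩ <;>
      simp [rW5]
  · rintro ⟨hA, hB, hx⟩ a b ha hab
    induction (show Relation.ReflTransGen rW5 a b from hab) with
    | refl => exact ha
    | tail h hr ih =>
      have hmem := ih h
      rcases hr with ⟨rfl, rfl⟩ | ⟨rfl, rfl⟩ | ⟨rfl, rfl⟩ | ⟨rfl, rfl⟩ | ⟨rfl, rfl⟩ | ⟨rfl, rfl⟩ <;>
        tauto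

open Classical in
/-- The map to `W5` induced by sets `A ⊆ U` and `B ⊆ V`. -/
noncomputable def W5.ofNhds {X : Type*} (A B U V : Set X) : X → W5 := fun p =>
  if p ∈ A then W5.A else if p ∈ B then W5.B else
    if p ∈ U then W5.UA else if p ∈ V then W5.UB else W5.x

theorem W5.q5_comp_ofNhds {X : Type*} (A B U V : Set X) :
    q5 ∘ W5.ofNhds A B U V = iAB A B := by
  funext p
  simp only [Function.comp_apply, W5.ofNhds, iAB]
  split_ifs <;> rfl

theorem W5.continuous_ofNhds {X : Type*} [TopologicalSpace X] {A B U V : Set X}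
    (hU : IsOpen U) (hV : IsOpen V) (hAU : A ⊆ U) (hBV : B ⊆ V) (hUV : Disjoint U V) :
    Continuous (W5.ofNhds A B U V) := by
  refine ⟨fun s hs => ?_⟩
  obtain ⟨hA, hB, hx⟩ := W5.isOpen_iff.1 hs
  have key : W5.ofNhds A B U V ⁻¹' s =
      {p | W5.x ∈ s} ∪ (U ∩ {p | W5.UA ∈ s}) ∪ (V ∩ {p | W5.UB ∈ s}) := by
    ext p
    have hpA := @hAU p
    have hpB := @hBV p
    have hpUV : p ∈ U → p ∉ V := fun h => Set.disjoint_left.1 hUV h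
    simp only [Set.mem_preimage, W5.ofNhds, Set.mem_union, Set.mem_inter_iff, Set.mem_ofPred_eq]
    split_ifs <;> tauto
  rw [key]
  exact (isOpen_const.union (hU.inter isOpen_const)).union (hV.inter isOpen_const)

/-- Disjoint subsets `A` and `B` of a topological space `X` are separated by
neighbourhoods (they have disjoint open neighbourhoods) iff the map
`i : X → I₃` factors continuously through `q : W → I₃`. -/
theorem statement3 {X : Type*} [TopologicalSpace X] (A B : Set X)
    (hAB : Disjoint A B) :
    (∃ U V : Set X, IsOpen U ∧ IsOpen V ∧ A ⊆ U ∧ B ⊆ V ∧ Disjoint U V) ↔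
      ∃ h : X → W5, Continuous h ∧ iAB A B = q5 ∘ h := by
  constructor
  · rintro ⟨U, V, hU, hV, hAU, hBV, hUV⟩
    exact ⟨W5.ofNhds A B U V, W5.continuous_ofNhds hU hV hAU hBV hUV,
      (W5.q5_comp_ofNhds A B U V).symm⟩
  · rintro ⟨h, hc, hi⟩
    refine ⟨h ⁻¹' {W5.A, W5.UA}, h ⁻¹' {W5.B, W5.UB},
      (W5.isOpen_iff.2 (by simp)).preimage hc, (W5.isOpen_iff.2 (by simp)).preimage hc,
      fun p hp => ?_, fun p hp => ?_, Disjoint.preimage h (by simp)⟩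
    · have hq : I3.A = q5 (h p) := by simpa [iAB, hp] using congrFun hi p
      cases hw : h p <;> simp_all [q5]
    · have hpA : p ∉ A := Set.disjoint_right.1 hAB hp
      have hq : I3.B = q5 (h p) := by simpa [iAB, hp, hpA] using congrFun hi p
      cases hw : h p <;> simp_all [q5]
end

section
/- Let X be a topological space and A, B disjoint subsets of X. Let I₃ be the three-point indiscrete space on points {A, x, B}, and let i : X → I₃ send points of A to A, points of B to B, and all other points to x. Let W be the seven-point space on {A, U_A, U'_A, x, U'_B, U_B, B} whose open sets are the up-sets of the preorder generated by A ↔ U_A, U'_A ≤ U_A, U'_A ≤ x, U'_B ≤ x, U'_B ≤ U_B, U_B ↔ B, and let q : W → I₃ glue U_A, U'_A, x, U'_B, U_B to the single point x. Then A and B are separated by closed neighbourhoods (A and B have disjoint closed neighbourhoods in X) if and only if i factors continuously through q. -/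
/-- The seven-point space on `{A, U_A, U'_A, x, U'_B, U_B, B}`. -/
inductive W7 | A | UA | UA' | x | UB' | UB | B

/-- Generating relation for the preorder on `W7`:
`A ↔ U_A`, `U'_A ≤ U_A`, `U'_A ≤ x`, `U'_B ≤ x`, `U'_B ≤ U_B`, `U_B ↔ B`. -/
def rW7 : W7 → W7 → Prop := fun p q =>
  (p = W7.A ∧ q = W7.UA) ∨ (p = W7.UA ∧ q = W7.A) ∨
  (p = W7.UA' ∧ q = W7.UA) ∨ (p = W7.UA' ∧ q = W7.x) ∨
  (p = W7.UB' ∧ q = W7.x) ∨ (p = W7.UB' ∧ q = W7.UB) ∨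
  (p = W7.UB ∧ q = W7.B) ∨ (p = W7.B ∧ q = W7.UB)

instance : Preorder W7 := genPreorder rW7
instance : TopologicalSpace W7 := upTop W7

/-- The quotient map `q : W → I₃` gluing `U_A`, `U'_A`, `x`, `U'_B`, `U_B` to the
single point `x`. -/
def q7 : W7 → I3
  | W7.A => I3.A
  | W7.UA => I3.x
  | W7.UA' => I3.x
  | W7.x => I3.x
  | W7.UB' => I3.x
  | W7.UB => I3.x
  | W7.B => I3.B

theorem isOpen_W7_iff {s : Set W7} :
    IsOpen s ↔ ∀ ⦃a b : W7⦄, rW7 a b → a ∈ s → b ∈ s := by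
  refine ⟨fun hs a b hab ha => hs ha (Relation.ReflTransGen.single hab), fun hs a b ha hab => ?_⟩
  change Relation.ReflTransGen rW7 a b at hab
  induction hab with
  | refl => exact ha
  | tail _ hbc ih => exact hs hbc ih

open Classical in
/-- The map `X → W7` determined by disjoint closed neighbourhoods `C` of `A` and `D` of `B`:
the interiors go to the open points, the boundaries to the closed points `UA'` and `UB'`. -/
noncomputable def toW7 {X : Type*} [TopologicalSpace X] (A B C D : Set X) : X → W7 := fun p =>
  if p ∈ interior C then (if p ∈ A then W7.A else W7.UA)
  else if p ∈ C then W7.UA'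
  else if p ∈ interior D then (if p ∈ B then W7.B else W7.UB)
  else if p ∈ D then W7.UB'
  else W7.x

theorem continuous_toW7 {X : Type*} [TopologicalSpace X] (A B : Set X) {C D : Set X}
    (hC : IsClosed C) (hD : IsClosed D) (hCD : Disjoint C D) :
    Continuous (toW7 A B C D) := by
  have hiC : interior C ⊆ C := interior_subset
  have hiD : interior D ⊆ D := interior_subset
  have hdisj : ∀ y, y ∈ C → y ∉ D := fun _ hy => Set.disjoint_left.mp hCD hy
  refine continuous_def.mpr fun s hs => isOpen_iff_mem_nhds.mpr fun p hp => ?_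
  rw [isOpen_W7_iff] at hs
  have h₁ : W7.A ∈ s ↔ W7.UA ∈ s := ⟨@hs _ _ (by simp [rW7]), @hs _ _ (by simp [rW7])⟩
  have h₂ : W7.B ∈ s ↔ W7.UB ∈ s := ⟨@hs _ _ (by simp [rW7]), @hs _ _ (by simp [rW7])⟩
  have h₃ : W7.UA' ∈ s → W7.UA ∈ s := @hs _ _ (by simp [rW7])
  have h₄ : W7.UA' ∈ s → W7.x ∈ s := @hs _ _ (by simp [rW7])
  have h₅ : W7.UB' ∈ s → W7.x ∈ s := @hs _ _ (by simp [rW7])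
  have h₆ : W7.UB' ∈ s → W7.UB ∈ s := @hs _ _ (by simp [rW7])
  simp only [Set.mem_preimage, toW7] at hp
  by_cases hpiC : p ∈ interior C
  · filter_upwards [isOpen_interior.mem_nhds hpiC] with y hy
    simp only [Set.mem_preimage, toW7]
    grind
  by_cases hpiD : p ∈ interior D
  · filter_upwards [isOpen_interior.mem_nhds hpiD] with y hy
    simp only [Set.mem_preimage, toW7]
    grind
  by_cases hpC : p ∈ C
  · filter_upwards [hD.isOpen_compl.mem_nhds (hdisj p hpC)] with y hy
    simp only [Set.mem_preimage, toW7]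
    grind
  by_cases hpD : p ∈ D
  · filter_upwards [hC.isOpen_compl.mem_nhds hpC] with y hy
    simp only [Set.mem_preimage, toW7]
    grind
  · filter_upwards [hC.isOpen_compl.mem_nhds hpC, hD.isOpen_compl.mem_nhds hpD] with y hy hy'
    simp only [Set.mem_preimage, toW7]
    grind

theorem iAB_eq_q7_comp_toW7 {X : Type*} [TopologicalSpace X] {A B C D : Set X}
    (hA : A ⊆ interior C) (hB : B ⊆ interior D) (hCD : Disjoint C D) :
    iAB A B = q7 ∘ toW7 A B C D := by
  have hiC : interior C ⊆ C := interior_subset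
  have hiD : interior D ⊆ D := interior_subset
  have hdisj : ∀ y, y ∈ C → y ∉ D := fun _ hy => Set.disjoint_left.mp hCD hy
  funext p
  simp only [iAB, toW7, Function.comp_apply]
  grind [q7]

/-- Disjoint subsets `A` and `B` of a topological space `X` are separated by
closed neighbourhoods (they have disjoint closed neighbourhoods, a closed
neighbourhood of `A` being a closed set whose interior contains `A`) iff the
map `i : X → I₃` factors continuously through `q : W → I₃`. -/
theorem statement4 {X : Type*} [TopologicalSpace X] (A B : Set X)
    (hAB : Disjoint A B) :
    (∃ C D : Set X, IsClosed C ∧ IsClosed D ∧ A ⊆ interior C ∧ B ⊆ interior D ∧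
      Disjoint C D) ↔
      ∃ h : X → W7, Continuous h ∧ iAB A B = q7 ∘ h := by
  constructor
  · rintro ⟨C, D, hC, hD, hA, hB, hCD⟩
    exact ⟨toW7 A B C D, continuous_toW7 A B hC hD hCD, iAB_eq_q7_comp_toW7 hA hB hCD⟩
  · rintro ⟨h, hh, hi⟩
    have hclosed : ∀ s : Set W7, IsOpen sᶜ → IsClosed (h ⁻¹' s) := fun s hs =>
      IsClosed.preimage hh ⟨hs⟩
    refine ⟨h ⁻¹' {W7.A, W7.UA, W7.UA'}, h ⁻¹' {W7.B, W7.UB, W7.UB'}, hclosed _ ?_,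
      hclosed _ ?_, fun p hp => ?_, fun p hp => ?_, ?_⟩
    · rw [isOpen_W7_iff]
      intro a b
      cases a <;> cases b <;> simp [rW7]
    · rw [isOpen_W7_iff]
      intro a b
      cases a <;> cases b <;> simp [rW7]
    · have hU : IsOpen ({W7.A, W7.UA} : Set W7) := by
        rw [isOpen_W7_iff]
        intro a b
        cases a <;> cases b <;> simp [rW7]
      refine interior_maximal (Set.preimage_mono ?_) (hU.preimage hh) ?_
      · intro w
        simp
        tauto
      · have := congrFun hi p
        simp only [iAB, hp, if_true, Function.comp_apply] at this
        cases hw : h p <;> simp_all [q7]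
    · have hU : IsOpen ({W7.B, W7.UB} : Set W7) := by
        rw [isOpen_W7_iff]
        intro a b
        cases a <;> cases b <;> simp [rW7]
      refine interior_maximal (Set.preimage_mono ?_) (hU.preimage hh) ?_
      · intro w
        simp
        tauto
      · have := congrFun hi p
        simp only [iAB, Set.disjoint_right.mp hAB hp, hp, if_true, if_false,
          Function.comp_apply] at this
        cases hw : h p <;> simp_all [q7]
    · refine Disjoint.preimage h (Set.disjoint_left.mpr fun w => ?_)
      cases w <;> simp
end

section
/- Let X be a topological space and A, B disjoint subsets of X. Let I₃ be the three-point indiscrete space on points {A, x, B}, and let i : X → I₃ send points of A to A, points of B to B, and all other points to x. Let R be the space obtained from the unit interval [0,1] by adding two points 0' and 1', where 0' is topologically indistinguishable from 0 and 1' is topologically indistinguishable from 1 (a set is open in R iff its intersection with [0,1] is open and it contains 0' iff it contains 0, and contains 1' iff it contains 1). Let q : R → I₃ send 0' to A, 1' to B, and every point of [0,1] to x. Then A and B are separated by a continuous function (there is a continuous f : X → ℝ with f ≡ 0 on A and f ≡ 1 on B) if and only if i factors continuously through q. -/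
/-- `0` as a point of the unit interval. -/
def i0 : Set.Icc (0:ℝ) 1 := ⟨0, by norm_num⟩

/-- `1` as a point of the unit interval. -/
def i1 : Set.Icc (0:ℝ) 1 := ⟨1, by norm_num⟩

/-- The space `R` obtained from the unit interval `[0,1]` by adding two extra
points `0'` (`z0`) and `1'` (`z1`). -/
inductive RSp | pt (t : Set.Icc (0:ℝ) 1) | z0 | z1

/-- Topology on `R`: a set is open iff its trace on `[0,1]` is open, it contains
`0'` iff it contains `0`, and it contains `1'` iff it contains `1`.  Thus `0'`
is topologically indistinguishable from `0`, and `1'` from `1`. -/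
instance : TopologicalSpace RSp where
  IsOpen s := IsOpen {t : Set.Icc (0:ℝ) 1 | RSp.pt t ∈ s} ∧
    (RSp.z0 ∈ s ↔ RSp.pt i0 ∈ s) ∧ (RSp.z1 ∈ s ↔ RSp.pt i1 ∈ s)
  isOpen_univ := by
    refine ⟨?_, Iff.rfl, Iff.rfl⟩
    simp only [Set.mem_univ, Set.setOf_true]
    exact isOpen_univ
  isOpen_inter := by
    rintro s t ⟨hs, hs0, hs1⟩ ⟨ht, ht0, ht1⟩
    exact ⟨hs.inter ht, and_congr hs0 ht0, and_congr hs1 ht1⟩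
  isOpen_sUnion := by
    intro S hS
    refine ⟨?_, ?_, ?_⟩
    · have h : {t : Set.Icc (0:ℝ) 1 | RSp.pt t ∈ ⋃₀ S} =
        ⋃ s ∈ S, {t : Set.Icc (0:ℝ) 1 | RSp.pt t ∈ s} := by
        ext u; simp
      rw [h]
      exact isOpen_biUnion fun s hs => (hS s hs).1
    · constructor
      · rintro ⟨s, hsS, hzs⟩
        exact ⟨s, hsS, ((hS s hsS).2.1).mp hzs⟩
      · rintro ⟨s, hsS, hzs⟩
        exact ⟨s, hsS, ((hS s hsS).2.1).mpr hzs⟩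
    · constructor
      · rintro ⟨s, hsS, hzs⟩
        exact ⟨s, hsS, ((hS s hsS).2.2).mp hzs⟩
      · rintro ⟨s, hsS, hzs⟩
        exact ⟨s, hsS, ((hS s hsS).2.2).mpr hzs⟩

/-- The map `q : R → I₃` sending `0'` to `A`, `1'` to `B`, and every point of
`[0,1]` to `x`. -/
def qR : RSp → I3
  | RSp.z0 => I3.A
  | RSp.z1 => I3.B
  | RSp.pt _ => I3.x

/-- The retraction of `R` onto `[0,1]` identifying `z0` with `0` and `z1` with `1`. -/
def RSp.retract : RSp → Set.Icc (0:ℝ) 1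
  | RSp.z0 => i0
  | RSp.z1 => i1
  | RSp.pt t => t

theorem RSp.isInducing_retract : Topology.IsInducing RSp.retract := by
  refine ⟨TopologicalSpace.ext_iff.mpr fun s => ?_⟩
  rw [isOpen_induced_iff]
  constructor
  · rintro ⟨hs, h0, h1⟩
    refine ⟨_, hs, ?_⟩
    ext p
    cases p with
    | pt t => exact Iff.rfl
    | z0 => exact h0.symm
    | z1 => exact h1.symm
  · rintro ⟨U, hU, rfl⟩
    exact ⟨hU, Iff.rfl, Iff.rfl⟩

theorem RSp.retract_of_qR_eq_A {p : RSp} (hp : qR p = I3.A) : p.retract = i0 := by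
  cases p <;> simp_all [qR, RSp.retract]

theorem RSp.retract_of_qR_eq_B {p : RSp} (hp : qR p = I3.B) : p.retract = i1 := by
  cases p <;> simp_all [qR, RSp.retract]

/-- Disjoint subsets `A` and `B` of a topological space `X` are separated by a
continuous function (there is a continuous `f : X → ℝ` with `f ≡ 0` on `A` and
`f ≡ 1` on `B`) iff the map `i : X → I₃` factors continuously through
`q : R → I₃`. -/
theorem statement5 {X : Type*} [TopologicalSpace X] (A B : Set X)
    (hAB : Disjoint A B) :
    (∃ f : X → ℝ, Continuous f ∧ (∀ a ∈ A, f a = 0) ∧ (∀ b ∈ B, f b = 1)) ↔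
      ∃ h : X → RSp, Continuous h ∧ iAB A B = qR ∘ h := by
  constructor
  · rintro ⟨f, hf, hA, hB⟩
    classical
    let g : X → Set.Icc (0:ℝ) 1 := fun p => Set.projIcc 0 1 zero_le_one (f p)
    have hg : Continuous g := continuous_projIcc.comp hf
    let h : X → RSp := fun p =>
      if p ∈ A then RSp.z0 else if p ∈ B then RSp.z1 else RSp.pt (g p)
    refine ⟨h, ?_, ?_⟩
    · have hgh : RSp.retract ∘ h = g := by
        funext p
        by_cases hpA : p ∈ A
        · simp [h, g, hpA, RSp.retract, hA p hpA, i0]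
        · by_cases hpB : p ∈ B
          · simp [h, g, hpA, hpB, RSp.retract, hB p hpB, i1]
          · simp [h, hpA, hpB, RSp.retract]
      rw [RSp.isInducing_retract.continuous_iff, hgh]
      exact hg
    · funext p
      by_cases hpA : p ∈ A
      · simp [iAB, h, hpA, qR]
      · by_cases hpB : p ∈ B <;> simp [iAB, h, hpA, hpB, qR]
  · rintro ⟨h, hh, hi⟩
    have hq (p : X) : qR (h p) = iAB A B p := (congrFun hi p).symm
    refine ⟨fun p => (h p).retract,
      continuous_subtype_val.comp (RSp.isInducing_retract.continuous.comp hh),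
      fun a ha => ?_, fun b hb => ?_⟩
    · have hqa : qR (h a) = I3.A := by rw [hq, iAB, if_pos ha]
      simp [RSp.retract_of_qR_eq_A hqa, i0]
    · have hqb : qR (h b) = I3.B := by
        rw [hq, iAB, if_neg (Set.disjoint_right.mp hAB hb), if_pos hb]
      simp [RSp.retract_of_qR_eq_B hqb, i1]
end

section
/- A topological space X is R0 (symmetric: any two topologically distinguishable points are separated, i.e. whenever y ∈ cl{x} then x and y are topologically indistinguishable) if and only if the identity-on-points map from the Sierpinski space to the two-point indiscrete space has the left lifting property with respect to the unique map from X to the one-point space. -/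
/-- A continuous map `f : A → B` has the left lifting property with respect to a
continuous map `g : Z → Y` if for all continuous `u : A → Z` and `v : B → Y`
with `g ∘ u = v ∘ f` there is a continuous `d : B → Z` with `d ∘ f = u` and
`g ∘ d = v`. -/
def HasLLP {A B Z Y : Type*} [TopologicalSpace A] [TopologicalSpace B]
    [TopologicalSpace Z] [TopologicalSpace Y] (f : A → B) (g : Z → Y) : Prop :=
  ∀ (u : A → Z) (v : B → Y), Continuous u → Continuous v → g ∘ u = v ∘ f →
    ∃ d : B → Z, Continuous d ∧ d ∘ f = u ∧ g ∘ d = v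

/-- The Sierpinski space: two points `o` (open) and `c` (closed). -/
inductive Sierp | o | c

/-- Topology on the Sierpinski space: the open sets are `∅`, `{o}` and the
whole space. -/
instance : TopologicalSpace Sierp where
  IsOpen s := Sierp.c ∈ s → Sierp.o ∈ s
  isOpen_univ := fun _ => trivial
  isOpen_inter := fun s t hs ht hc => ⟨hs hc.1, ht hc.2⟩
  isOpen_sUnion := fun S hS hc => by
    obtain ⟨s, hsS, hcs⟩ := hc
    exact ⟨s, hsS, hS s hsS hcs⟩

/-- The two-point indiscrete space on the same two points `o`, `c`: only `∅` and
the whole space are open. -/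
inductive TwoInd | o | c

instance : TopologicalSpace TwoInd := ⊤

/-- The identity-on-points map from the Sierpinski space to the two-point
indiscrete space. -/
def sierpToInd : Sierp → TwoInd
  | Sierp.o => TwoInd.o
  | Sierp.c => TwoInd.c

theorem continuous_sierp_iff {X : Type*} [TopologicalSpace X] {u : Sierp → X} :
    Continuous u ↔ u Sierp.c ∈ closure {u Sierp.o} := by
  rw [← specializes_iff_mem_closure, specializes_iff_forall_open, continuous_def]
  rfl

theorem continuous_twoInd_iff {X : Type*} [TopologicalSpace X] {d : TwoInd → X} :
    Continuous d ↔ Inseparable (d TwoInd.o) (d TwoInd.c) := by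
  rw [inseparable_iff_forall_isOpen, continuous_def]
  refine forall₂_congr fun U _ => ?_
  rw [TopologicalSpace.isOpen_top_iff]
  constructor
  · rintro (h | h)
    · exact iff_of_false (fun ho => h.subset ho) (fun hc => h.subset hc)
    · exact iff_of_true (h.superset trivial) (h.superset trivial)
  · intro h
    by_cases ho : d TwoInd.o ∈ U
    · right
      ext (_ | _)
      exacts [iff_of_true ho trivial, iff_of_true (h.1 ho) trivial]
    · left
      ext (_ | _)
      exacts [iff_of_false ho id, iff_of_false (fun hc => ho (h.2 hc)) id]

/-- A topological space `X` is R0 (symmetric: whenever `y ∈ closure {x}` the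
points `x` and `y` are topologically indistinguishable) iff the
identity-on-points map from the Sierpinski space to the two-point indiscrete
space has the left lifting property with respect to the unique map from `X` to
the one-point space. -/
theorem statement8 {X : Type*} [TopologicalSpace X] :
    (∀ x y : X, y ∈ closure {x} → ∀ U : Set X, IsOpen U → (x ∈ U ↔ y ∈ U)) ↔
      HasLLP sierpToInd (fun _ : X => PUnit.unit) := by
  constructor
  · intro hR u v hu _ _
    refine ⟨fun b => TwoInd.casesOn b (u Sierp.o) (u Sierp.c), ?_, ?_, rfl⟩
    · exact continuous_twoInd_iff.2
        (inseparable_iff_forall_isOpen.2 (hR _ _ (continuous_sierp_iff.1 hu)))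
    · funext s
      cases s <;> rfl
  · intro hL x y hxy
    obtain ⟨d, hd, hdu, -⟩ := hL (fun s => Sierp.casesOn s x y) (fun _ => PUnit.unit)
      (continuous_sierp_iff.2 hxy) continuous_const rfl
    have hx : d TwoInd.o = x := congrFun hdu Sierp.o
    have hy : d TwoInd.c = y := congrFun hdu Sierp.c
    have hi := continuous_twoInd_iff.1 hd
    rw [hx, hy] at hi
    exact inseparable_iff_forall_isOpen.1 hi
end

section
/- A topological space X is Urysohn (T2½: any two distinct points have disjoint closed neighbourhoods) if and only if for every injective continuous map j from the two-point discrete space into X, j has the left lifting property with respect to the unique map from D₅ to the one-point space, where D₅ is the five-point space on {a, a', z, b', b} whose open sets are the up-sets of the preorder generated by a' ≤ a, a' ≤ z, b' ≤ z, b' ≤ b (p ≤ q meaning p ∈ cl{q}). -/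
/-- The two-point discrete space. -/
inductive TwoD | a | b

instance : TopologicalSpace TwoD := ⊥

/-- The five-point space on `{a, a', z, b', b}`. -/
inductive D5 | a | a' | z | b' | b

/-- Generating relation for the preorder on `D5`:
`a' ≤ a`, `a' ≤ z`, `b' ≤ z`, `b' ≤ b` (`p ≤ q` meaning `p ∈ closure {q}`). -/
def rD5 : D5 → D5 → Prop := fun p q =>
  (p = D5.a' ∧ q = D5.a) ∨ (p = D5.a' ∧ q = D5.z) ∨
  (p = D5.b' ∧ q = D5.z) ∨ (p = D5.b' ∧ q = D5.b)

instance : Preorder D5 := genPreorder rD5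
instance : TopologicalSpace D5 := upTop D5

namespace D5

/-- The preorder on `D5` adds only equalities to the generating relation. -/
theorem le_iff {p q : D5} : p ≤ q ↔ p = q ∨ rD5 p q := by
  refine ⟨fun h => ?_, ?_⟩
  · change Relation.ReflTransGen rD5 p q at h
    induction h with
    | refl => exact Or.inl rfl
    | tail _ h ih =>
      rcases ih with rfl | ih
      · exact Or.inr h
      · simp only [rD5] at h ih
        grind
  · rintro (rfl | h)
    · exact le_rfl
    · exact Relation.ReflTransGen.single h

theorem isOpen_iff {s : Set D5} : IsOpen s ↔ IsUpperSet s :=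
  ⟨fun h _ _ hle ha => h ha hle, fun h _ _ ha hle => h hle ha⟩

theorem continuous_of_monotone {f : D5 → D5} (hf : Monotone f) : Continuous f :=
  continuous_def.2 fun _ hs => isOpen_iff.2 ((isOpen_iff.1 hs).preimage hf)

/-- The position of a point on the zigzag `a ≥ a' ≤ z ≥ b' ≤ b`. -/
def index : D5 → Fin 5
  | a => 0
  | a' => 1
  | z => 2
  | b' => 3
  | b => 4

/-- The point at a given position on the zigzag `a ≥ a' ≤ z ≥ b' ≤ b`. -/
def ofIndex : Fin 5 → D5
  | 0 => a
  | 1 => a'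
  | 2 => z
  | 3 => b'
  | 4 => b

/-- Clamping the zigzag, reversed when necessary, to the segment between `p` and `q`. -/
def clamp (p q t : D5) : D5 :=
  if p.index ≤ q.index then ofIndex (max p.index (min q.index t.index))
  else ofIndex (max q.index (min p.index t.index.rev))

theorem clamp_monotone (p q : D5) : Monotone (clamp p q) := by
  intro s t h
  rw [le_iff] at h ⊢
  rcases h with rfl | ⟨rfl, rfl⟩ | ⟨rfl, rfl⟩ | ⟨rfl, rfl⟩ | ⟨rfl, rfl⟩
  · exact Or.inl rfl
  all_goals cases p <;> cases q <;> simp [clamp, index, rD5] <;> simp [ofIndex]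

theorem clamp_a (p q : D5) : clamp p q a = p := by
  cases p <;> cases q <;> rfl

theorem clamp_b (p q : D5) : clamp p q b = q := by
  cases p <;> cases q <;> rfl

end D5

open Classical in
/-- Points with disjoint closed neighbourhoods are separated by a continuous map to `D5`. -/
theorem exists_continuous_D5 {X : Type*} [TopologicalSpace X] {x y : X} {C D : Set X}
    (hC : IsClosed C) (hD : IsClosed D) (hx : x ∈ interior C) (hy : y ∈ interior D)
    (hCD : Disjoint C D) :
    ∃ d : X → D5, Continuous d ∧ d x = D5.a ∧ d y = D5.b := by
  have hdis : ∀ w, w ∈ C → w ∉ D := fun w h h' => Set.disjoint_left.1 hCD h h'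
  have hiC : ∀ w, w ∈ interior C → w ∈ C := fun w h => interior_subset h
  have hiD : ∀ w, w ∈ interior D → w ∈ D := fun w h => interior_subset h
  let d : X → D5 := fun w =>
    if w ∈ interior C then D5.a else if w ∈ C then D5.a'
    else if w ∈ interior D then D5.b else if w ∈ D then D5.b' else D5.z
  refine ⟨d, ?_, by grind, by grind⟩
  refine continuous_def.2 fun s hs => isOpen_iff_forall_mem_open.2 fun w hw => ?_
  have up : ∀ p q, rD5 p q → p ∈ s → q ∈ s := fun p q h hp =>
    D5.isOpen_iff.1 hs (D5.le_iff.2 (Or.inr h)) hp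
  have h1 := up D5.a' D5.a (by simp [rD5])
  have h2 := up D5.a' D5.z (by simp [rD5])
  have h3 := up D5.b' D5.z (by simp [rD5])
  have h4 := up D5.b' D5.b (by simp [rD5])
  simp only [Set.mem_preimage] at hw
  by_cases hwC : w ∈ interior C
  · exact ⟨_, fun v hv => by simp only [Set.mem_preimage]; grind, isOpen_interior, hwC⟩
  by_cases hwD : w ∈ interior D
  · exact ⟨_, fun v hv => by simp only [Set.mem_preimage]; grind, isOpen_interior, hwD⟩
  by_cases hwC' : w ∈ C
  · exact ⟨Dᶜ, fun v hv => by simp only [Set.mem_preimage, Set.mem_compl_iff] at hv ⊢; grind,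
      hD.isOpen_compl, hdis w hwC'⟩
  by_cases hwD' : w ∈ D
  · exact ⟨Cᶜ, fun v hv => by simp only [Set.mem_preimage, Set.mem_compl_iff] at hv ⊢; grind,
      hC.isOpen_compl, hwC'⟩
  · exact ⟨Cᶜ ∩ Dᶜ, fun v hv => by
      simp only [Set.mem_preimage, Set.mem_inter_iff, Set.mem_compl_iff] at hv ⊢; grind,
      hC.isOpen_compl.inter hD.isOpen_compl, hwC', hwD'⟩

/-- Points separated by a continuous map to `D5` have disjoint closed neighbourhoods. -/
theorem exists_disjoint_isClosed_of_continuous_D5 {X : Type*} [TopologicalSpace X] {x y : X}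
    {d : X → D5} (hd : Continuous d) (hx : d x = D5.a) (hy : d y = D5.b) :
    ∃ C D : Set X, IsClosed C ∧ IsClosed D ∧ x ∈ interior C ∧ y ∈ interior D ∧ Disjoint C D := by
  have open_of : ∀ s : Set D5, (∀ p q, rD5 p q → p ∈ s → q ∈ s) → IsOpen (d ⁻¹' s) :=
    fun s hs => (D5.isOpen_iff.2 fun p q hle hp => by
      rcases D5.le_iff.1 hle with rfl | h
      exacts [hp, hs p q h hp]).preimage hd
  refine ⟨d ⁻¹' {D5.a, D5.a'}, d ⁻¹' {D5.b, D5.b'}, ?_, ?_, ?_, ?_, ?_⟩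
  · exact ⟨open_of {D5.a, D5.a'}ᶜ (by simp [rD5]; grind)⟩
  · exact ⟨open_of {D5.b, D5.b'}ᶜ (by simp [rD5]; grind)⟩
  · exact mem_interior.2 ⟨d ⁻¹' {D5.a}, Set.preimage_mono (by simp),
      open_of _ (by simp [rD5]; grind), hx⟩
  · exact mem_interior.2 ⟨d ⁻¹' {D5.b}, Set.preimage_mono (by simp),
      open_of _ (by simp [rD5]; grind), hy⟩
  · exact Disjoint.preimage d (by simp)

/-- A topological space `X` is Urysohn (T2½: any two distinct points have
disjoint closed neighbourhoods, a closed neighbourhood of `x` being a closed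
set whose interior contains `x`) iff every injective continuous map `j` from the
two-point discrete space into `X` has the left lifting property with respect to
the unique map from `D₅` to the one-point space. -/
theorem statement11 {X : Type*} [TopologicalSpace X] :
    (∀ x y : X, x ≠ y → ∃ C D : Set X, IsClosed C ∧ IsClosed D ∧
      x ∈ interior C ∧ y ∈ interior D ∧ Disjoint C D) ↔
      ∀ j : TwoD → X, Continuous j → Function.Injective j →
        HasLLP j (fun _ : D5 => PUnit.unit) := by
  constructor
  · intro h j _ hj u v _ _ _
    obtain ⟨C, D, hC, hD, hx, hy, hCD⟩ := h (j TwoD.a) (j TwoD.b) (hj.ne (by simp))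
    obtain ⟨d, hd, hda, hdb⟩ := exists_continuous_D5 hC hD hx hy hCD
    refine ⟨D5.clamp (u TwoD.a) (u TwoD.b) ∘ d,
      (D5.continuous_of_monotone (D5.clamp_monotone _ _)).comp hd, ?_, rfl⟩
    funext t
    cases t
    · simp [hda, D5.clamp_a]
    · simp [hdb, D5.clamp_b]
  · intro h x y hxy
    let j : TwoD → X := fun t => TwoD.casesOn t x y
    let u : TwoD → D5 := fun t => TwoD.casesOn t D5.a D5.b
    have hj : Function.Injective j := by
      rintro (_ | _) (_ | _) h
      exacts [rfl, (hxy h).elim, (hxy h.symm).elim, rfl]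
    obtain ⟨d, hd, hdj, -⟩ := h j continuous_bot hj u (fun _ => PUnit.unit)
      continuous_bot continuous_const rfl
    exact exists_disjoint_isClosed_of_continuous_D5 hd (congrFun hdj TwoD.a) (congrFun hdj TwoD.b)
end

section
/- A topological space X is completely Hausdorff (any two distinct points x, y are separated by a continuous function: there is a continuous f : X → ℝ with f(x) = 0 and f(y) = 1) if and only if for every injective continuous map j from the two-point discrete space into X, j has the left lifting property with respect to the unique map from the unit interval [0,1] to the one-point space. -/
/-- A topological space `X` is completely Hausdorff (any two distinct points
`x`, `y` are separated by a continuous function: there is a continuous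
`f : X → ℝ` with `f x = 0` and `f y = 1`) iff every injective continuous map
`j` from the two-point discrete space into `X` has the left lifting property
with respect to the unique map from the unit interval `[0,1]` to the one-point
space. -/
theorem statement12 {X : Type*} [TopologicalSpace X] :
    (∀ x y : X, x ≠ y → ∃ f : X → ℝ, Continuous f ∧ f x = 0 ∧ f y = 1) ↔
      ∀ j : TwoD → X, Continuous j → Function.Injective j →
        HasLLP j (fun _ : Set.Icc (0:ℝ) 1 => PUnit.unit) := by
  have : DiscreteTopology TwoD := ⟨rfl⟩
  constructor
  · intro h j _ hj u v _ _ _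
    obtain ⟨f, hf, hfa, hfb⟩ := h (j .a) (j .b) (hj.ne (by simp))
    refine ⟨fun x => Set.projIcc 0 1 zero_le_one
      ((u .a : ℝ) + f x * ((u .b : ℝ) - u .a)), ?_, ?_, rfl⟩
    · exact continuous_projIcc.comp (by fun_prop)
    · funext t
      cases t <;> simp [hfa, hfb, Set.projIcc_val]
  · intro h x y hxy
    have hinj : Function.Injective (fun t : TwoD => TwoD.casesOn t x y : TwoD → X) := by
      rintro (_ | _) (_ | _) hst
      exacts [rfl, (hxy hst).elim, (hxy hst.symm).elim, rfl]
    obtain ⟨d, hd, hdu, -⟩ := h _ continuous_of_discreteTopology hinj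
      (fun t => TwoD.casesOn t 0 1) (fun _ => PUnit.unit)
      continuous_of_discreteTopology continuous_const rfl
    refine ⟨fun z => d z, by fun_prop, ?_, ?_⟩
    · exact congrArg Subtype.val (congrFun hdu .a)
    · exact congrArg Subtype.val (congrFun hdu .b)
end

section
/- A topological space X is regular (for every point x and closed set F with x ∉ F, x and F have disjoint open neighbourhoods) if and only if for every point x of X, the map from the one-point space to X with image x has the left lifting property with respect to the map q : D₄ → S, where D₄ is the four-point space on {a, z, u, f} whose open sets are the up-sets of the preorder generated by z ≤ a, z ≤ u, f ≤ u (p ≤ q meaning p ∈ cl{q}), S is the Sierpinski space with open point o and closed point c, and q sends a, z, u to o and f to c. -/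
/-- The four-point space on `{a, z, u, f}`. -/
inductive D4 | a | z | u | f

/-- Generating relation for the preorder on `D4`: `z ≤ a`, `z ≤ u`, `f ≤ u`
(`p ≤ q` meaning `p ∈ closure {q}`). -/
def rD4 : D4 → D4 → Prop := fun p q =>
  (p = D4.z ∧ q = D4.a) ∨ (p = D4.z ∧ q = D4.u) ∨ (p = D4.f ∧ q = D4.u)

instance : Preorder D4 := genPreorder rD4
instance : TopologicalSpace D4 := upTop D4

/-- The map `q : D₄ → S` sending `a`, `z`, `u` to the open point `o` and `f` to
the closed point `c`. -/
def qD4 : D4 → Sierp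
  | D4.a => Sierp.o
  | D4.z => Sierp.o
  | D4.u => Sierp.o
  | D4.f => Sierp.c

theorem D4.le_iff (p q : D4) : p ≤ q ↔ p = q ∨ rD4 p q := by
  constructor
  · intro h
    change Relation.ReflTransGen rD4 p q at h
    induction h with
    | refl => exact Or.inl rfl
    | tail _ hr ih =>
      rcases ih with rfl | ih
      · exact Or.inr hr
      · simp only [rD4] at *
        aesop
  · rintro (rfl | h)
    · exact le_refl _
    · exact Relation.ReflTransGen.single h

theorem D4.isOpen_iff (s : Set D4) :
    IsOpen s ↔ (D4.z ∈ s → D4.a ∈ s ∧ D4.u ∈ s) ∧ (D4.f ∈ s → D4.u ∈ s) := by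
  change (∀ ⦃p q : D4⦄, p ∈ s → p ≤ q → q ∈ s) ↔ _
  simp only [D4.le_iff, rD4]
  constructor
  · intro h
    exact ⟨fun hz => ⟨h hz (by simp), h hz (by simp)⟩, fun hf => h hf (by simp)⟩
  · rintro ⟨hz, hf⟩ p q hp (rfl | ⟨rfl, rfl⟩ | ⟨rfl, rfl⟩ | ⟨rfl, rfl⟩)
    exacts [hp, (hz hp).1, (hz hp).2, hf hp]

theorem Sierp.isOpen_iff (s : Set Sierp) : IsOpen s ↔ (Sierp.c ∈ s → Sierp.o ∈ s) := Iff.rfl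

theorem Sierp.continuous_iff {X : Type*} [TopologicalSpace X] (v : X → Sierp) :
    Continuous v ↔ IsClosed {y | v y = Sierp.c} := by
  have hcompl : {y | v y = Sierp.c}ᶜ = v ⁻¹' {Sierp.o} := by
    ext y
    cases h : v y <;> simp [h]
  rw [← isOpen_compl_iff, hcompl]
  refine ⟨fun h => h.isOpen_preimage _ (by simp [Sierp.isOpen_iff]),
    fun h => ⟨fun s hs => ?_⟩⟩
  rw [Sierp.isOpen_iff] at hs
  by_cases hc : Sierp.c ∈ s
  · have : s = Set.univ := Set.eq_univ_of_forall fun t => by cases t; exacts [hs hc, hc]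
    simp [this]
  by_cases ho : Sierp.o ∈ s
  · have : s = {Sierp.o} := by
      ext t
      cases t <;> simp [ho, hc]
    rwa [this]
  · have : s = ∅ := Set.eq_empty_of_forall_notMem fun t => by cases t; exacts [ho, hc]
    simp [this]

open Classical in
/-- The map to `D4` with value `f` on `F`, `u` on `V \ F`, `a` on `U \ V` and `z` elsewhere. -/
noncomputable def D4.ofSets {X : Type*} (U V F : Set X) (y : X) : D4 :=
  if y ∈ F then D4.f else if y ∈ V then D4.u else if y ∈ U then D4.a else D4.z

theorem D4.continuous_ofSets {X : Type*} [TopologicalSpace X] {U V F : Set X} (hU : IsOpen U)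
    (hV : IsOpen V) (hF : IsClosed F) (hFV : F ⊆ V) (hUV : Disjoint U V) :
    Continuous (D4.ofSets U V F) := by
  refine ⟨fun s hs => ?_⟩
  rw [D4.isOpen_iff] at hs
  have key : D4.ofSets U V F ⁻¹' s =
      {y | y ∈ U ∧ D4.a ∈ s} ∪ {y | y ∈ V \ F ∧ D4.u ∈ s} ∪
        {y | y ∈ Fᶜ ∧ D4.z ∈ s} ∪ {y | y ∈ V ∧ D4.f ∈ s} := by
    ext y
    have h₁ := @hFV y
    have h₂ : y ∈ U → y ∉ V := fun h => Set.disjoint_left.1 hUV h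
    simp only [D4.ofSets, Set.mem_preimage, Set.mem_union, Set.mem_ofPred_eq, Set.mem_sdiff,
      Set.mem_compl_iff]
    split_ifs <;> tauto
  rw [key]
  exact (((hU.and isOpen_const).union ((hV.sdiff hF).and isOpen_const)).union
    (hF.isOpen_compl.and isOpen_const)).union (hV.and isOpen_const)

theorem qD4_ofSets {X : Type*} (U V : Set X) (v : X → Sierp) :
    qD4 ∘ D4.ofSets U V {y | v y = Sierp.c} = v := by
  funext y
  cases h : v y <;> simp only [Function.comp, D4.ofSets, Set.mem_ofPred_eq, h] <;>
    split_ifs <;> simp_all [qD4]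

/-- A topological space `X` is regular (every point `x` and closed set `F` with
`x ∉ F` have disjoint open neighbourhoods) iff for every point `x` of `X`, the
map from the one-point space to `X` with image `x` has the left lifting
property with respect to the map `q : D₄ → S`. -/
theorem statement13 {X : Type*} [TopologicalSpace X] :
    (∀ (x : X) (F : Set X), IsClosed F → x ∉ F →
      ∃ U V : Set X, IsOpen U ∧ IsOpen V ∧ x ∈ U ∧ F ⊆ V ∧ Disjoint U V) ↔
      ∀ x : X, HasLLP (fun _ : PUnit => x) qD4 := by
  classical
  constructor
  · intro hreg x w v _ hv hcomm
    have hF := (Sierp.continuous_iff v).1 hv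
    have hx : qD4 (w PUnit.unit) = v x := congrFun hcomm PUnit.unit
    suffices ∃ U V : Set X, IsOpen U ∧ IsOpen V ∧ {y | v y = Sierp.c} ⊆ V ∧ Disjoint U V ∧
        D4.ofSets U V {y | v y = Sierp.c} x = w PUnit.unit by
      obtain ⟨U, V, hU, hV, hFV, hUV, hw⟩ := this
      exact ⟨_, D4.continuous_ofSets hU hV hF hFV hUV, funext fun _ => hw, qD4_ofSets U V v⟩
    cases hw : w PUnit.unit <;> simp only [hw, qD4] at hx
    case a =>
      obtain ⟨U, V, hU, hV, hxU, hFV, hUV⟩ := hreg x _ hF (by simp [← hx])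
      exact ⟨U, V, hU, hV, hFV, hUV, by
        simp [D4.ofSets, ← hx, hxU, Set.disjoint_left.1 hUV hxU]⟩
    case z =>
      obtain ⟨U, V, -, hV, hxU, hFV, hUV⟩ := hreg x _ hF (by simp [← hx])
      exact ⟨∅, V, isOpen_empty, hV, hFV, Set.empty_disjoint V, by
        simp [D4.ofSets, ← hx, Set.disjoint_left.1 hUV hxU]⟩
    all_goals exact ⟨∅, Set.univ, isOpen_empty, isOpen_univ, Set.subset_univ _,
      Set.empty_disjoint _, by simp [D4.ofSets, ← hx]⟩
  · intro h x F hF hx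
    let v : X → Sierp := fun y => if y ∈ F then Sierp.c else Sierp.o
    have hv : Continuous v := by
      rw [Sierp.continuous_iff]
      simpa [v] using hF
    obtain ⟨d, hd, hdx, hdv⟩ := h x (fun _ => D4.a) v continuous_const hv
      (funext fun _ => by simp [v, hx, qD4])
    refine ⟨d ⁻¹' {D4.a}, d ⁻¹' {D4.u, D4.f}, hd.isOpen_preimage _ (by simp [D4.isOpen_iff]),
      hd.isOpen_preimage _ (by simp [D4.isOpen_iff]), congrFun hdx PUnit.unit, fun y hy => ?_,
      Disjoint.preimage d (by simp)⟩
    have hy' : qD4 (d y) = Sierp.c := by simpa [v, hy] using congrFun hdv y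
    cases hdy : d y <;> simp_all [qD4]
end

section
/- A topological space X is normal (any two disjoint closed subsets have disjoint open neighbourhoods) if and only if the map from the empty space to X has the left lifting property with respect to the map q : D₅ → C₃, where D₅ is the five-point space on {p, p', z, q', r} whose open sets are the up-sets of the preorder generated by p ≤ p', z ≤ p', z ≤ q', r ≤ q' (a ≤ b meaning a ∈ cl{b}), C₃ is the three-point space on {p, m, r} whose open sets are the up-sets of the preorder generated by p ≤ m, r ≤ m, and q sends p to p, r to r, and p', z, q' to m. -/
/-- The three-point space on `{p, m, r}`. -/
inductive C3 | p | m | r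

/-- Generating relation for the preorder on `C3`: `p ≤ m` and `r ≤ m`
(`a ≤ b` meaning `a ∈ closure {b}`). -/
def rC3 : C3 → C3 → Prop := fun a b =>
  (a = C3.p ∧ b = C3.m) ∨ (a = C3.r ∧ b = C3.m)

instance : Preorder C3 := genPreorder rC3
instance : TopologicalSpace C3 := upTop C3

/-- The five-point space on `{p, p', z, q', r}`. -/
inductive D5n | p | p' | z | q' | r

/-- Generating relation for the preorder on `D5n`:
`p ≤ p'`, `z ≤ p'`, `z ≤ q'`, `r ≤ q'` (`a ≤ b` meaning `a ∈ closure {b}`). -/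
def rD5n : D5n → D5n → Prop := fun a b =>
  (a = D5n.p ∧ b = D5n.p') ∨ (a = D5n.z ∧ b = D5n.p') ∨
  (a = D5n.z ∧ b = D5n.q') ∨ (a = D5n.r ∧ b = D5n.q')

instance : Preorder D5n := genPreorder rD5n
instance : TopologicalSpace D5n := upTop D5n

/-- The map `q : D₅ → C₃` sending `p` to `p`, `r` to `r`, and `p'`, `z`, `q'`
to `m`. -/
def qD5n : D5n → C3
  | D5n.p => C3.p
  | D5n.p' => C3.m
  | D5n.z => C3.m
  | D5n.q' => C3.m
  | D5n.r => C3.r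

theorem isOpen_upTop_genPreorder {α : Type*} {r : α → α → Prop} {s : Set α}
    (h : ∀ a b, r a b → a ∈ s → b ∈ s) : @IsOpen α (@upTop α (genPreorder r)) s := by
  intro a b ha hab
  induction hab with
  | refl => exact ha
  | tail _ hr ih => exact h _ _ hr ih

theorem continuous_upTop_of_local_le {X α : Type*} [TopologicalSpace X] [Preorder α] {f : X → α}
    (h : ∀ x, ∃ W : Set X, IsOpen W ∧ x ∈ W ∧ ∀ y ∈ W, f x ≤ f y) :
    @Continuous _ _ _ (upTop α) f := by
  refine @Continuous.mk _ _ _ (upTop α) _ fun s hs => isOpen_iff_forall_mem_open.2 fun x hx => ?_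
  obtain ⟨W, hW, hxW, hle⟩ := h x
  exact ⟨W, fun y hy => hs hx (hle y hy), hW, hxW⟩

theorem C3.isClosed_p : IsClosed ({C3.p} : Set C3) := by
  refine ⟨isOpen_upTop_genPreorder ?_⟩
  rintro a b (⟨rfl, rfl⟩ | ⟨rfl, rfl⟩) <;> simp

theorem C3.isClosed_r : IsClosed ({C3.r} : Set C3) := by
  refine ⟨isOpen_upTop_genPreorder ?_⟩
  rintro a b (⟨rfl, rfl⟩ | ⟨rfl, rfl⟩) <;> simp

theorem C3.le_m (a : C3) : a ≤ C3.m := by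
  cases a
  · exact .single (.inl ⟨rfl, rfl⟩)
  · exact le_refl _
  · exact .single (.inr ⟨rfl, rfl⟩)

theorem D5n.isOpen_p_p' : IsOpen ({D5n.p, D5n.p'} : Set D5n) := by
  refine isOpen_upTop_genPreorder ?_
  rintro a b (⟨rfl, rfl⟩ | ⟨rfl, rfl⟩ | ⟨rfl, rfl⟩ | ⟨rfl, rfl⟩) <;> simp

theorem D5n.isOpen_r_q' : IsOpen ({D5n.r, D5n.q'} : Set D5n) := by
  refine isOpen_upTop_genPreorder ?_
  rintro a b (⟨rfl, rfl⟩ | ⟨rfl, rfl⟩ | ⟨rfl, rfl⟩ | ⟨rfl, rfl⟩) <;> simp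

theorem D5n.p_le_p' : D5n.p ≤ D5n.p' := .single (.inl ⟨rfl, rfl⟩)

theorem D5n.z_le_p' : D5n.z ≤ D5n.p' := .single (.inr (.inl ⟨rfl, rfl⟩))

theorem D5n.z_le_q' : D5n.z ≤ D5n.q' := .single (.inr (.inr (.inl ⟨rfl, rfl⟩)))

theorem D5n.r_le_q' : D5n.r ≤ D5n.q' := .single (.inr (.inr (.inr ⟨rfl, rfl⟩)))

open Classical in
/-- The map to `C3` with fibre `A` over `p` and fibre `B \ A` over `r`. -/
noncomputable def toC3 {X : Type*} (A B : Set X) (x : X) : C3 :=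
  if x ∈ A then C3.p else if x ∈ B then C3.r else C3.m

theorem continuous_toC3 {X : Type*} [TopologicalSpace X] {A B : Set X} (hA : IsClosed A)
    (hB : IsClosed B) (hAB : Disjoint A B) : Continuous (toC3 A B) := by
  refine continuous_upTop_of_local_le fun x => ?_
  by_cases hxA : x ∈ A
  · refine ⟨Bᶜ, hB.isOpen_compl, hAB.notMem_of_mem_left hxA, fun y hy => ?_⟩
    by_cases hyA : y ∈ A
    · simp [toC3, hxA, hyA]
    · simpa [toC3, hxA, hyA, show y ∉ B from hy] using C3.le_m C3.p
  by_cases hxB : x ∈ B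
  · refine ⟨Aᶜ, hA.isOpen_compl, hxA, fun y hy => ?_⟩
    have hyA : y ∉ A := hy
    by_cases hyB : y ∈ B
    · simp [toC3, hxA, hxB, hyA, hyB]
    · simpa [toC3, hxA, hxB, hyA, hyB] using C3.le_m C3.r
  · refine ⟨Aᶜ ∩ Bᶜ, hA.isOpen_compl.inter hB.isOpen_compl, ⟨hxA, hxB⟩, fun y hy => ?_⟩
    simp [toC3, hxA, hxB, show y ∉ A from hy.1, show y ∉ B from hy.2]

open Classical in
/-- The lift to `D5n` of a map to `C3` determined by neighbourhoods `U` and `V` of the fibres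
over `p` and `r`. -/
noncomputable def liftD5n {X : Type*} (v : X → C3) (U V : Set X) (x : X) : D5n :=
  match v x with
  | C3.p => D5n.p
  | C3.r => D5n.r
  | C3.m => if x ∈ U then D5n.p' else if x ∈ V then D5n.q' else D5n.z

theorem qD5n_liftD5n {X : Type*} (v : X → C3) (U V : Set X) (x : X) :
    qD5n (liftD5n v U V x) = v x := by
  unfold liftD5n
  cases v x <;> dsimp only <;> (try split_ifs) <;> rfl

theorem continuous_liftD5n {X : Type*} [TopologicalSpace X] {v : X → C3} (hv : Continuous v)
    {U V : Set X} (hU : IsOpen U) (hV : IsOpen V) (hpU : v ⁻¹' {C3.p} ⊆ U)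
    (hrV : v ⁻¹' {C3.r} ⊆ V) (hUV : Disjoint U V) : Continuous (liftD5n v U V) := by
  have hp := (C3.isClosed_p.preimage hv).isOpen_compl
  have hr := (C3.isClosed_r.preimage hv).isOpen_compl
  have p_notMem_V {y : X} (hy : v y = C3.p) : y ∉ V := hUV.notMem_of_mem_left (hpU hy)
  have r_notMem_U {y : X} (hy : v y = C3.r) : y ∉ U := hUV.notMem_of_mem_right (hrV hy)
  refine continuous_upTop_of_local_le fun x => ?_
  cases hx : v x with
  | p =>
    refine ⟨U, hU, hpU hx, fun y hy => ?_⟩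
    cases hvy : v y with
    | p => simp [liftD5n, hx, hvy]
    | m => simpa [liftD5n, hx, hvy, hy] using D5n.p_le_p'
    | r => exact absurd hy (r_notMem_U hvy)
  | r =>
    refine ⟨V, hV, hrV hx, fun y hy => ?_⟩
    cases hvy : v y with
    | p => exact absurd hy (p_notMem_V hvy)
    | m =>
      simpa [liftD5n, hx, hvy, hy, hUV.notMem_of_mem_right hy] using D5n.r_le_q'
    | r => simp [liftD5n, hx, hvy]
  | m =>
    have hm {y : X} (hy : y ∈ (v ⁻¹' {C3.p})ᶜ ∩ (v ⁻¹' {C3.r})ᶜ) : v y = C3.m := by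
      obtain ⟨h₁, h₂⟩ := hy
      cases h : v y <;> simp_all
    have hxm : x ∈ (v ⁻¹' {C3.p})ᶜ ∩ (v ⁻¹' {C3.r})ᶜ := by simp [hx]
    by_cases hxU : x ∈ U
    · refine ⟨_, (hp.inter hr).inter hU, ⟨hxm, hxU⟩, fun y hy => ?_⟩
      simp [liftD5n, hx, hxU, hm hy.1, hy.2]
    by_cases hxV : x ∈ V
    · refine ⟨_, (hp.inter hr).inter hV, ⟨hxm, hxV⟩, fun y hy => ?_⟩
      simp [liftD5n, hx, hxU, hxV, hm hy.1, hy.2, hUV.notMem_of_mem_right hy.2]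
    · refine ⟨_, hp.inter hr, hxm, fun y hy => ?_⟩
      simp only [liftD5n, hx, hm hy, hxU, hxV, if_false]
      split_ifs
      exacts [D5n.z_le_p', D5n.z_le_q', le_rfl]

/-- A topological space `X` is normal (any two disjoint closed subsets have
disjoint open neighbourhoods) iff the map from the empty space to `X` has the
left lifting property with respect to the map `q : D₅ → C₃`. -/
theorem statement14 {X : Type*} [TopologicalSpace X] :
    (∀ A B : Set X, IsClosed A → IsClosed B → Disjoint A B →
      ∃ U V : Set X, IsOpen U ∧ IsOpen V ∧ A ⊆ U ∧ B ⊆ V ∧ Disjoint U V) ↔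
      HasLLP (Empty.elim : Empty → X) qD5n := by
  constructor
  · intro hX u v _ hv _
    obtain ⟨U, V, hU, hV, hpU, hrV, hUV⟩ := hX _ _ (C3.isClosed_p.preimage hv)
      (C3.isClosed_r.preimage hv) (Disjoint.preimage v (by simp))
    exact ⟨liftD5n v U V, continuous_liftD5n hv hU hV hpU hrV hUV, funext fun e => e.elim,
      funext (qD5n_liftD5n v U V)⟩
  · intro hX A B hA hB hAB
    obtain ⟨d, hd, -, hqd⟩ := hX Empty.elim (toC3 A B) continuous_of_discreteTopology
      (continuous_toC3 hA hB hAB) (funext fun e => e.elim)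
    refine ⟨d ⁻¹' {D5n.p, D5n.p'}, d ⁻¹' {D5n.r, D5n.q'}, D5n.isOpen_p_p'.preimage hd,
      D5n.isOpen_r_q'.preimage hd, fun x hx => ?_, fun x hx => ?_, Disjoint.preimage d (by simp)⟩
    · have h : qD5n (d x) = C3.p := by simpa [toC3, hx] using congrFun hqd x
      cases hdx : d x <;> simp_all [qD5n]
    · have h : qD5n (d x) = C3.r := by
        simpa [toC3, hx, hAB.notMem_of_mem_right hx] using congrFun hqd x
      cases hdx : d x <;> simp_all [qD5n]
end
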